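/- arXiv:1810.11601 — 3 statements merged into one kernel-verified Lean document; each statement's English description precedes it below -/
import Mathlib

section
/- DFIG and rotor-side-converter subsystem scaling. Let N be a positive integer and let omega_nom, omega_s, Ls', T_r, R1, R2, Xm, K_mrr be positive reals and kp_RPC, ki_RPC, kp_RTC, ki_RTC, kpd_RCC, kid_RCC, kpq_RCC, kiq_RCC, K_opt, q* real. Let v_g^q, v_g^d, omega_r : [t0, oo) -> R be given functions. Suppose the differentiable functions (i_s^d, i_s^q, phi_r^q, phi_r^t, phi_r^id, phi_r^iq, e_s^d, e_s^q) : [t0, oo) -> R^8 satisfy the individual DFIG/rotor-side-converter dynamics given in the context for all t >= t0. Then the functions (N i_s^d, N i_s^q, N phi_r^q, N phi_r^t, N phi_r^id, N phi_r^iq, e_s^d, e_s^q) satisfy, for all t >= t0, the aggregate dynamics obtained by the substitutions (R1, R2, Ls', Xm, kpd_RCC, kid_RCC, kpq_RCC, kiq_RCC, K_opt, q*) -> (R1/N, R2/N, Ls'/N, Xm/N, kpd_RCC/N, kid_RCC/N, kpq_RCC/N, kiq_RCC/N, N K_opt, N q*), with the same grid-voltage functions v_g^q, v_g^d and the same generator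 speed omega_r. -/
/-!
Statement 2: DFIG and rotor-side-converter subsystem scaling.
-/

/-- The individual DFIG/rotor-side-converter dynamics: the 8 state functions
`(i_s^d, i_s^q, φ_r^q, φ_r^t, φ_r^id, φ_r^iq, e_s^d, e_s^q)` satisfy the
dynamics driven by given grid voltages `v_g^q, v_g^d` and generator speed
`ω_r` on `[t0, ∞)`. -/
def DFIGSol (wnom ws Lsp Tr R1 R2 Xm Kmrr
    kpRPC kiRPC kpRTC kiRTC kpdRCC kidRCC kpqRCC kiqRCC Kopt qstar : ℝ)
    (t0 : ℝ) (vgq vgd wr : ℝ → ℝ)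
    (isd isq phirq phirt phirid phiriq esd esq : ℝ → ℝ) : Prop :=
  ∀ t, t0 ≤ t →
    let qs := -vgq t * isd t + vgd t * isq t
    let Te := (vgq t * isq t + vgd t * isd t) / ws
    let ird := esq t / Xm - Kmrr * isd t
    let irq := esd t / Xm - Kmrr * isq t
    let irdstar := kpRPC * (qstar - qs) + kiRPC * phirq t
    let irqstar := kpRTC * (Kopt * (wr t)^2 - Te) + kiRTC * phirt t
    let vrd := kpdRCC * (irdstar - ird) + kidRCC * phirid t
    let vrq := kpqRCC * (irqstar - irq) + kiqRCC * phiriq t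
    HasDerivAt isq ((wnom / Lsp) * (-R1 * isq t + ws * Lsp * isd t
        + (wr t / ws) * esq t - esd t / (Tr * ws) - vgq t + Kmrr * vrq)) t
    ∧ HasDerivAt isd ((wnom / Lsp) * (-R1 * isd t - ws * Lsp * isq t
        + (wr t / ws) * esd t + esq t / (Tr * ws) - vgd t + Kmrr * vrd)) t
    ∧ HasDerivAt esq ((wnom * ws) * (R2 * isd t - esq t / (Tr * ws)
        + (1 - wr t / ws) * esd t - Kmrr * vrd)) t
    ∧ HasDerivAt esd (-(wnom * ws) * (R2 * isq t + esd t / (Tr * ws)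
        + (1 - wr t / ws) * esq t - Kmrr * vrq)) t
    ∧ HasDerivAt phirq (qstar - qs) t
    ∧ HasDerivAt phirt (Kopt * (wr t)^2 - Te) t
    ∧ HasDerivAt phirid (irdstar - ird) t
    ∧ HasDerivAt phiriq (irqstar - irq) t

/-- DFIG and rotor-side-converter subsystem scaling: if the 8 states solve the
individual dynamics, then `(N i_s^d, N i_s^q, N φ_r^q, N φ_r^t, N φ_r^id,
N φ_r^iq, e_s^d, e_s^q)` solve the aggregate dynamics obtained by the
substitutions `(R1, R2, Ls', Xm, kpd_RCC, kid_RCC, kpq_RCC, kiq_RCC, K_opt,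
q*) → (R1/N, R2/N, Ls'/N, Xm/N, kpd_RCC/N, kid_RCC/N, kpq_RCC/N, kiq_RCC/N,
N K_opt, N q*)`, with the same `v_g^q, v_g^d, ω_r`. -/
theorem dfig_subsystem_scaling
    (N : ℕ) (hN : 0 < N)
    (wnom ws Lsp Tr R1 R2 Xm Kmrr : ℝ)
    (hwnom : 0 < wnom) (hws : 0 < ws) (hLsp : 0 < Lsp) (hTr : 0 < Tr)
    (hR1 : 0 < R1) (hR2 : 0 < R2) (hXm : 0 < Xm) (hKmrr : 0 < Kmrr)
    (kpRPC kiRPC kpRTC kiRTC kpdRCC kidRCC kpqRCC kiqRCC Kopt qstar : ℝ)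
    (t0 : ℝ) (vgq vgd wr : ℝ → ℝ)
    (isd isq phirq phirt phirid phiriq esd esq : ℝ → ℝ)
    (hsol : DFIGSol wnom ws Lsp Tr R1 R2 Xm Kmrr
      kpRPC kiRPC kpRTC kiRTC kpdRCC kidRCC kpqRCC kiqRCC Kopt qstar
      t0 vgq vgd wr isd isq phirq phirt phirid phiriq esd esq) :
    DFIGSol wnom ws (Lsp / (N : ℝ)) Tr (R1 / (N : ℝ)) (R2 / (N : ℝ))
      (Xm / (N : ℝ)) Kmrr
      kpRPC kiRPC kpRTC kiRTC (kpdRCC / (N : ℝ)) (kidRCC / (N : ℝ))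
      (kpqRCC / (N : ℝ)) (kiqRCC / (N : ℝ)) ((N : ℝ) * Kopt) ((N : ℝ) * qstar)
      t0 vgq vgd wr
      (fun t => (N : ℝ) * isd t) (fun t => (N : ℝ) * isq t)
      (fun t => (N : ℝ) * phirq t) (fun t => (N : ℝ) * phirt t)
      (fun t => (N : ℝ) * phirid t) (fun t => (N : ℝ) * phiriq t)
      esd esq := by
  have hN0 : (N : ℝ) ≠ 0 := Nat.cast_ne_zero.mpr hN.ne'
  intro t ht
  obtain ⟨hisq, hisd, hesq, hesd, hphirq, hphirt, hphirid, hphiriq⟩ := hsol t ht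
  refine ⟨(hisq.const_mul (N : ℝ)).congr_deriv ?_, (hisd.const_mul (N : ℝ)).congr_deriv ?_,
    hesq.congr_deriv ?_, hesd.congr_deriv ?_,
    (hphirq.const_mul (N : ℝ)).congr_deriv ?_, (hphirt.const_mul (N : ℝ)).congr_deriv ?_,
    (hphirid.const_mul (N : ℝ)).congr_deriv ?_, (hphiriq.const_mul (N : ℝ)).congr_deriv ?_⟩ <;>
  · field_simp
    try ring
end

section
/- Grid-side converter subsystem scaling. Let N be a positive integer and let omega_nom, L_i, L_g, C_f, omega_cPC, omega_cPLL be positive reals and kp_GPC, ki_GPC, kp_GCC, ki_GCC, kp_PLL, ki_PLL, q* real. Let v_g^a, v_g^b, v_g^c, p_r : [t0, oo) -> R be given functions. Suppose the differentiable functions (i_i^d, i_i^q, i_g^d, i_g^q, phi_g^id, phi_g^iq, p_avg, q_avg, phi_g^p, phi_g^q, v_f^d, v_f^q, v_PLL, phi_PLL, delta) : [t0, oo) -> R^15 satisfy the individual grid-side-converter dynamics given in the context for all t >= t0. Then the functions (N i_i^d, N i_i^q, N i_g^d, N i_g^q, N phi_g^id, N phi_g^iq, N p_avg, N q_avg, N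 phi_g^p, N phi_g^q, v_f^d, v_f^q, v_PLL, phi_PLL, delta) satisfy, for all t >= t0, the aggregate dynamics obtained by the substitutions (L_i, L_g, C_f, kp_GCC, ki_GCC) -> (L_i/N, L_g/N, N C_f, kp_GCC/N, ki_GCC/N) and the reference substitutions (p_r, q*) -> (N p_r, N q*), with the same grid-voltage functions v_g^a, v_g^b, v_g^c. -/
/-!
Statement 4: Grid-side converter subsystem scaling.
-/

/-- The individual grid-side-converter dynamics: the 15 state functions
`(i_i^d, i_i^q, i_g^d, i_g^q, φ_g^id, φ_g^iq, p_avg, q_avg, φ_g^p, φ_g^q,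
v_f^d, v_f^q, v_PLL, φ_PLL, δ)` satisfy the dynamics driven by given grid
voltages `v_g^a, v_g^b, v_g^c` and rotor power reference `p_r` on
`[t0, ∞)`. -/
def GSCSol (wnom Li Lg Cf wcPC wcPLL
    kpGPC kiGPC kpGCC kiGCC kpPLL kiPLL qstar : ℝ)
    (t0 : ℝ) (vga vgb vgc pr : ℝ → ℝ)
    (iid iiq igd igq phigid phigiq pavg qavg phigp phigq vfd vfq vPLL phiPLL
      dlt : ℝ → ℝ) : Prop :=
  ∀ t, t0 ≤ t →
    let vgq := (2/3) * (Real.cos (dlt t) * vga t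
      + Real.cos (dlt t - 2*Real.pi/3) * vgb t
      + Real.cos (dlt t + 2*Real.pi/3) * vgc t)
    let vgd := -(2/3) * (Real.sin (dlt t) * vga t
      + Real.sin (dlt t - 2*Real.pi/3) * vgb t
      + Real.sin (dlt t + 2*Real.pi/3) * vgc t)
    let wPLL := 1 - kpPLL * vPLL t + kiPLL * phiPLL t
    let pg := vgd * igd t + vgq * igq t
    let qg := -vgq * igd t + vgd * igq t
    let iidstar := kpGPC * (qstar - qavg t) + kiGPC * phigq t
    let iiqstar := kpGPC * (pr t - pavg t) + kiGPC * phigp t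
    let vid := kpGCC * (iidstar - iid t) + kiGCC * phigid t
    let viq := kpGCC * (iiqstar - iiq t) + kiGCC * phigiq t
    HasDerivAt iid ((wnom / Li) * (vid - vfd t) + wnom * wPLL * iiq t) t
    ∧ HasDerivAt iiq ((wnom / Li) * (viq - vfq t) - wnom * wPLL * iid t) t
    ∧ HasDerivAt igd ((wnom / Lg) * (vfd t - vgd) + wnom * wPLL * igq t) t
    ∧ HasDerivAt igq ((wnom / Lg) * (vfq t - vgq) - wnom * wPLL * igd t) t
    ∧ HasDerivAt vfd ((wnom / Cf) * (iid t - igd t) + wnom * wPLL * vfq t) t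
    ∧ HasDerivAt vfq ((wnom / Cf) * (iiq t - igq t) - wnom * wPLL * vfd t) t
    ∧ HasDerivAt pavg (wcPC * (pg - pavg t)) t
    ∧ HasDerivAt qavg (wcPC * (qg - qavg t)) t
    ∧ HasDerivAt phigp (pr t - pavg t) t
    ∧ HasDerivAt phigq (qstar - qavg t) t
    ∧ HasDerivAt phigid (iidstar - iid t) t
    ∧ HasDerivAt phigiq (iiqstar - iiq t) t
    ∧ HasDerivAt vPLL (wcPLL * (vgd - vPLL t)) t
    ∧ HasDerivAt phiPLL (-vPLL t) t
    ∧ HasDerivAt dlt wPLL t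

/-- Grid-side converter subsystem scaling: if the 15 states solve the
individual grid-side-converter dynamics, then
`(N i_i^d, N i_i^q, N i_g^d, N i_g^q, N φ_g^id, N φ_g^iq, N p_avg, N q_avg,
N φ_g^p, N φ_g^q, v_f^d, v_f^q, v_PLL, φ_PLL, δ)` solve the aggregate dynamics
obtained by the substitutions `(L_i, L_g, C_f, kp_GCC, ki_GCC) →
(L_i/N, L_g/N, N C_f, kp_GCC/N, ki_GCC/N)` and the reference substitutions
`(p_r, q*) → (N p_r, N q*)`, with the same grid voltages. -/
theorem gsc_subsystem_scaling
    (N : ℕ) (hN : 0 < N)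
    (wnom Li Lg Cf wcPC wcPLL : ℝ)
    (hwnom : 0 < wnom) (hLi : 0 < Li) (hLg : 0 < Lg) (hCf : 0 < Cf)
    (hwcPC : 0 < wcPC) (hwcPLL : 0 < wcPLL)
    (kpGPC kiGPC kpGCC kiGCC kpPLL kiPLL qstar : ℝ)
    (t0 : ℝ) (vga vgb vgc pr : ℝ → ℝ)
    (iid iiq igd igq phigid phigiq pavg qavg phigp phigq vfd vfq vPLL phiPLL
      dlt : ℝ → ℝ)
    (hsol : GSCSol wnom Li Lg Cf wcPC wcPLL
      kpGPC kiGPC kpGCC kiGCC kpPLL kiPLL qstar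
      t0 vga vgb vgc pr
      iid iiq igd igq phigid phigiq pavg qavg phigp phigq vfd vfq vPLL phiPLL
      dlt) :
    GSCSol wnom (Li / (N : ℝ)) (Lg / (N : ℝ)) ((N : ℝ) * Cf) wcPC wcPLL
      kpGPC kiGPC (kpGCC / (N : ℝ)) (kiGCC / (N : ℝ)) kpPLL kiPLL
      ((N : ℝ) * qstar)
      t0 vga vgb vgc (fun t => (N : ℝ) * pr t)
      (fun t => (N : ℝ) * iid t) (fun t => (N : ℝ) * iiq t)
      (fun t => (N : ℝ) * igd t) (fun t => (N : ℝ) * igq t)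
      (fun t => (N : ℝ) * phigid t) (fun t => (N : ℝ) * phigiq t)
      (fun t => (N : ℝ) * pavg t) (fun t => (N : ℝ) * qavg t)
      (fun t => (N : ℝ) * phigp t) (fun t => (N : ℝ) * phigq t)
      vfd vfq vPLL phiPLL dlt := by
  have hN0 : (N : ℝ) ≠ 0 := Nat.cast_ne_zero.mpr hN.ne'
  intro t ht
  obtain ⟨hiid, hiiq, higd, higq, hvfd, hvfq, hpavg, hqavg, hphigp, hphigq, hphigid, hphigiq,
    hvPLL, hphiPLL, hdlt⟩ := hsol t ht
  refine ⟨(hiid.const_mul (N : ℝ)).congr_deriv ?_, (hiiq.const_mul (N : ℝ)).congr_deriv ?_,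
    (higd.const_mul (N : ℝ)).congr_deriv ?_, (higq.const_mul (N : ℝ)).congr_deriv ?_,
    hvfd.congr_deriv ?_, hvfq.congr_deriv ?_,
    (hpavg.const_mul (N : ℝ)).congr_deriv ?_, (hqavg.const_mul (N : ℝ)).congr_deriv ?_,
    (hphigp.const_mul (N : ℝ)).congr_deriv ?_, (hphigq.const_mul (N : ℝ)).congr_deriv ?_,
    (hphigid.const_mul (N : ℝ)).congr_deriv ?_, (hphigiq.const_mul (N : ℝ)).congr_deriv ?_,
    hvPLL, hphiPLL, hdlt⟩
  all_goals
    generalize Real.cos (dlt t - 2 * Real.pi / 3) = c₁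
    generalize Real.cos (dlt t + 2 * Real.pi / 3) = c₂
    generalize Real.sin (dlt t - 2 * Real.pi / 3) = s₁
    generalize Real.sin (dlt t + 2 * Real.pi / 3) = s₂
    field_simp
    try ring
end

section
/- Mechanically coupled turbine/DFIG/rotor-side-converter subsystem scaling. Let N be a positive integer; let omega_nom, omega_s, H_g, H_t, k_sh, c_sh, T_mbase, R, rho, Ls', T_r, R1, R2, Xm, K_mrr be positive reals; let beta, kp_RPC, ki_RPC, kp_RTC, ki_RTC, kpd_RCC, kid_RCC, kpq_RCC, kiq_RCC, K_opt, q* be reals and C_p : R x R -> R an arbitrary function. Let v_g^q, v_g^d, v_w : [t0, oo) -> R be given functions with v_w(t) != 0. Suppose the differentiable functions (omega_r, omega_t, theta_tw, i_s^d, i_s^q, phi_r^q, phi_r^t, phi_r^id, phi_r^iq, e_s^d, e_s^q) : [t0, oo) -> R^11 with omega_t(t) != 0 satisfy the coupled individual dynamics given in the context for all t >= t0. Then the functions (omega_r, omega_t, theta_tw, N i_s^d, N i_s^q, N phi_r^q, N phi_r^t, N phi_r^id, N phi_r^iq, e_s^d, e_s^q) satisfy, for all t >= t0, the aggregate dynamics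 obtained by the substitutions (H_g, H_t, k_sh, c_sh, T_mbase, R1, R2, Ls', Xm, kpd_RCC, kid_RCC, kpq_RCC, kiq_RCC, K_opt, q*) -> (N H_g, N H_t, N k_sh, N c_sh, T_mbase/N, R1/N, R2/N, Ls'/N, Xm/N, kpd_RCC/N, kid_RCC/N, kpq_RCC/N, kiq_RCC/N, N K_opt, N q*), with the same grid voltages v_g^q, v_g^d and the same wind speed v_w. -/
/-!
Statement 9: Mechanically coupled turbine/DFIG/rotor-side-converter subsystem
scaling.
-/

/-- Coupled individual dynamics of the turbine, DFIG, and rotor-side converter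
(11 states: `ω_r, ω_t, θ_tw, i_s^d, i_s^q, φ_r^q, φ_r^t, φ_r^id, φ_r^iq,
e_s^d, e_s^q`), driven by grid voltages `v_g^q, v_g^d` and wind speed
`v_w` on `[t0, ∞)`. -/
def TurbineDFIGSol (wnom ws Hg Ht ksh csh Tmbase R rho Lsp Tr R1 R2 Xm Kmrr
    beta kpRPC kiRPC kpRTC kiRTC kpdRCC kidRCC kpqRCC kiqRCC Kopt qstar : ℝ)
    (Cp : ℝ → ℝ → ℝ) (t0 : ℝ) (vgq vgd vw : ℝ → ℝ)
    (wr wt thtw isd isq phirq phirt phirid phiriq esd esq : ℝ → ℝ) : Prop :=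
  ∀ t, t0 ≤ t →
    let qs := -vgq t * isd t + vgd t * isq t
    let Te := (vgq t * isq t + vgd t * isd t) / ws
    let Tm := (1/(2*Tmbase)) * (rho * Real.pi * R^2
      * Cp (wt t * R / vw t) beta * (vw t)^3 / wt t)
    let ird := esq t / Xm - Kmrr * isd t
    let irq := esd t / Xm - Kmrr * isq t
    let irdstar := kpRPC * (qstar - qs) + kiRPC * phirq t
    let irqstar := kpRTC * (Kopt * (wr t)^2 - Te) + kiRTC * phirt t
    let vrd := kpdRCC * (irdstar - ird) + kidRCC * phirid t
    let vrq := kpqRCC * (irqstar - irq) + kiqRCC * phiriq t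
    HasDerivAt wr ((1/(2*Hg)) * (ksh * thtw t
        + csh * wnom * (wt t - wr t) - Te)) t
    ∧ HasDerivAt thtw (wnom * (wt t - wr t)) t
    ∧ HasDerivAt wt ((1/(2*Ht)) * (Tm - ksh * thtw t
        - csh * wnom * (wt t - wr t))) t
    ∧ HasDerivAt isq ((wnom / Lsp) * (-R1 * isq t + ws * Lsp * isd t
        + (wr t / ws) * esq t - esd t / (Tr * ws) - vgq t + Kmrr * vrq)) t
    ∧ HasDerivAt isd ((wnom / Lsp) * (-R1 * isd t - ws * Lsp * isq t
        + (wr t / ws) * esd t + esq t / (Tr * ws) - vgd t + Kmrr * vrd)) t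
    ∧ HasDerivAt esq ((wnom * ws) * (R2 * isd t - esq t / (Tr * ws)
        + (1 - wr t / ws) * esd t - Kmrr * vrd)) t
    ∧ HasDerivAt esd (-(wnom * ws) * (R2 * isq t + esd t / (Tr * ws)
        + (1 - wr t / ws) * esq t - Kmrr * vrq)) t
    ∧ HasDerivAt phirq (qstar - qs) t
    ∧ HasDerivAt phirt (Kopt * (wr t)^2 - Te) t
    ∧ HasDerivAt phirid (irdstar - ird) t
    ∧ HasDerivAt phiriq (irqstar - irq) t

/-- Mechanically coupled turbine/DFIG/rotor-side-converter subsystem scaling: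
if the 11 states solve the coupled individual dynamics (with nonvanishing wind
and turbine speed), then `(ω_r, ω_t, θ_tw, N i_s^d, N i_s^q, N φ_r^q,
N φ_r^t, N φ_r^id, N φ_r^iq, e_s^d, e_s^q)` solve the aggregate dynamics
obtained by the substitutions `(H_g, H_t, k_sh, c_sh, T_mbase, R1, R2, Ls',
Xm, kpd_RCC, kid_RCC, kpq_RCC, kiq_RCC, K_opt, q*) → (N H_g, N H_t, N k_sh,
N c_sh, T_mbase/N, R1/N, R2/N, Ls'/N, Xm/N, kpd_RCC/N, kid_RCC/N, kpq_RCC/N,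
kiq_RCC/N, N K_opt, N q*)`, with the same grid voltages and wind speed. -/
theorem turbine_dfig_subsystem_scaling
    (N : ℕ) (hN : 0 < N)
    (wnom ws Hg Ht ksh csh Tmbase R rho Lsp Tr R1 R2 Xm Kmrr : ℝ)
    (hwnom : 0 < wnom) (hws : 0 < ws) (hHg : 0 < Hg) (hHt : 0 < Ht)
    (hksh : 0 < ksh) (hcsh : 0 < csh) (hTmb : 0 < Tmbase) (hR : 0 < R)
    (hrho : 0 < rho) (hLsp : 0 < Lsp) (hTr : 0 < Tr) (hR1 : 0 < R1)
    (hR2 : 0 < R2) (hXm : 0 < Xm) (hKmrr : 0 < Kmrr)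
    (beta kpRPC kiRPC kpRTC kiRTC kpdRCC kidRCC kpqRCC kiqRCC Kopt qstar : ℝ)
    (Cp : ℝ → ℝ → ℝ) (t0 : ℝ) (vgq vgd vw : ℝ → ℝ)
    (hvw : ∀ t, t0 ≤ t → vw t ≠ 0)
    (wr wt thtw isd isq phirq phirt phirid phiriq esd esq : ℝ → ℝ)
    (hwt : ∀ t, t0 ≤ t → wt t ≠ 0)
    (hsol : TurbineDFIGSol wnom ws Hg Ht ksh csh Tmbase R rho Lsp Tr R1 R2 Xm
      Kmrr beta kpRPC kiRPC kpRTC kiRTC kpdRCC kidRCC kpqRCC kiqRCC Kopt qstar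
      Cp t0 vgq vgd vw wr wt thtw isd isq phirq phirt phirid phiriq esd esq) :
    TurbineDFIGSol wnom ws ((N : ℝ) * Hg) ((N : ℝ) * Ht) ((N : ℝ) * ksh)
      ((N : ℝ) * csh) (Tmbase / (N : ℝ)) R rho (Lsp / (N : ℝ)) Tr
      (R1 / (N : ℝ)) (R2 / (N : ℝ)) (Xm / (N : ℝ)) Kmrr
      beta kpRPC kiRPC kpRTC kiRTC (kpdRCC / (N : ℝ)) (kidRCC / (N : ℝ))
      (kpqRCC / (N : ℝ)) (kiqRCC / (N : ℝ)) ((N : ℝ) * Kopt) ((N : ℝ) * qstar)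
      Cp t0 vgq vgd vw
      wr wt thtw
      (fun t => (N : ℝ) * isd t) (fun t => (N : ℝ) * isq t)
      (fun t => (N : ℝ) * phirq t) (fun t => (N : ℝ) * phirt t)
      (fun t => (N : ℝ) * phirid t) (fun t => (N : ℝ) * phiriq t)
      esd esq := by
  have hN' : (N : ℝ) ≠ 0 := by exact_mod_cast hN.ne'
  intro t ht
  obtain ⟨hwr, hthtw, hwt', hisq, hisd, hesq, hesd, hphirq, hphirt, hphirid, hphiriq⟩ :=
    hsol t ht
  have hwtt := hwt t ht
  have hvwt := hvw t ht
  refine ⟨hwr.congr_deriv ?_, hthtw, hwt'.congr_deriv ?_,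
    (hisq.const_mul (N : ℝ)).congr_deriv ?_, (hisd.const_mul (N : ℝ)).congr_deriv ?_,
    hesq.congr_deriv ?_, hesd.congr_deriv ?_,
    (hphirq.const_mul (N : ℝ)).congr_deriv ?_, (hphirt.const_mul (N : ℝ)).congr_deriv ?_,
    (hphirid.const_mul (N : ℝ)).congr_deriv ?_, (hphiriq.const_mul (N : ℝ)).congr_deriv ?_⟩ <;>
  · field_simp
    try ring
end
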